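/- arXiv:2504.13533 — 2 statements merged into one kernel-verified Lean document; each statement's English description precedes it below -/
import Mathlib

section
/- For all 0 < γ < 1 and all real x > −1, one has (1+x)^γ ≥ 1 + γ·x − (1−γ)·x². -/
open Real

/-- For all `0 < γ < 1` and all real `x > −1`,
`(1+x)^γ ≥ 1 + γ·x − (1−γ)·x²`, where `(1+x)^γ` is the real power. -/
theorem rpow_ge_quadratic_lower_bound (γ : ℝ) (hγ : γ ∈ Set.Ioo (0:ℝ) 1)
    (x : ℝ) (hx : -1 < x) :
    1 + γ * x - (1 - γ) * x ^ 2 ≤ (1 + x) ^ γ := by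
  obtain ⟨hγ0, hγ1⟩ := hγ
  have ht : 0 < 1 + x := by linarith
  have bernoulli : (1 + x) ^ (1 - γ) ≤ 1 + (1 - γ) * x :=
    rpow_one_add_le_one_add_mul_self hx.le (by linarith) (by linarith)
  have hden : 0 < 1 + (1 - γ) * x := (rpow_pos_of_pos ht _).trans_le bernoulli
  have hsplit : (1 + x) ^ γ * (1 + x) ^ (1 - γ) = 1 + x := by
    rw [← rpow_add ht, add_sub_cancel, rpow_one]
  calc 1 + γ * x - (1 - γ) * x ^ 2
      = (1 + x) * (1 - (1 - γ) * x) := by ring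
    _ ≤ (1 + x) / (1 + (1 - γ) * x) := by
      rw [le_div_iff₀ hden, mul_assoc]
      exact mul_le_of_le_one_right ht.le (by nlinarith [sq_nonneg ((1 - γ) * x)])
    _ ≤ (1 + x) ^ γ := by
      rw [div_le_iff₀ hden]
      exact hsplit.symm.trans_le (by gcongr)
end

section
/- Let f be a continuously differentiable, strictly positive probability density on (0,∞), let ν_{f,N} be the product probability measure on ℝ_{≥0}^N with density ∏_{j=1}^N f(η_j), and for E > 0 let σ_{f,N,E} be the conditional distribution of ν_{f,N} on the simplex S_{N,E} = {η : (1/N)Σ η_j = E}. For t > 0 let S_t(η) = t^{−1}·η, which maps S_{N,E} onto S_{N,E/t}. Then, for a fixed N ≥ 2 and E > 0: the push-forward identity S_t # σ_{f,N,E} = σ_{f,N,tE} holds for all t > 0 if and only if f is a Gamma density, i.e. f(x) = (λ^α/Γ(α))·x^{α−1}·e^{−λx} for some α, λ > 0. -/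
open MeasureTheory Real Set

noncomputable section

/-- The simplex `S_{N,E} = {η ∈ ℝ_{≥0}^N : (1/N)·Σ η_j = E}`. -/
def expSimplex (N : ℕ) (E : ℝ) : Set (Fin N → ℝ) :=
  {η | (∀ j, 0 ≤ η j) ∧ ∑ j, η j = N * E}

/-- The conditional distribution `σ_{f,N,E}` of the product measure with one-dimensional
density `f` on the simplex `S_{N,E}`: the probability measure on `S_{N,E}` whose density
with respect to the uniform (Hausdorff) measure on `S_{N,E}` is proportional to
`∏_j f(η_j)`. -/
def condProduct (f : ℝ → ℝ) (N : ℕ) (E : ℝ) : Measure (Fin N → ℝ) :=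
  ((((μH[(N : ℝ) - 1]).restrict (expSimplex N E)).withDensity
      (fun η => ENNReal.ofReal (∏ j, f (η j)))) Set.univ)⁻¹ •
    (((μH[(N : ℝ) - 1]).restrict (expSimplex N E)).withDensity
      (fun η => ENNReal.ofReal (∏ j, f (η j))))

/-- The hyperplane of vectors whose coordinates sum to zero. -/
def zeroSum (N : ℕ) : Submodule ℝ (Fin N → ℝ) :=
  LinearMap.ker (∑ j, LinearMap.proj j : (Fin N → ℝ) →ₗ[ℝ] ℝ)

theorem mem_zeroSum {N : ℕ} {v : Fin N → ℝ} : v ∈ zeroSum N ↔ ∑ j, v j = 0 := by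
  simp [zeroSum]

theorem finrank_zeroSum {N : ℕ} (hN : 2 ≤ N) :
    ((Module.finrank ℝ (zeroSum N) : ℕ) : ℝ) = (N : ℝ) - 1 := by
  have hne : (∑ j, LinearMap.proj j : Module.Dual ℝ (Fin N → ℝ)) ≠ 0 := by
    intro h
    have := congrArg (fun l : Module.Dual ℝ (Fin N → ℝ) => l (fun _ => 1)) h
    simp at this
    omega
  have := Module.Dual.finrank_ker_add_one_of_ne_zero hne
  rw [Module.finrank_fin_fun] at this
  have h2 : Module.finrank ℝ (zeroSum N) + 1 = N := this
  rw [eq_sub_iff_add_eq]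
  exact_mod_cast h2

/-- The translation of the hyperplane `zeroSum N` onto the vectors with mean `c`. -/
def shift (N : ℕ) (c : ℝ) (v : zeroSum N) : Fin N → ℝ := fun j => (v : Fin N → ℝ) j + c

theorem isometry_shift (N : ℕ) (c : ℝ) : Isometry (shift N c) :=
  (isometry_add_right (fun _ : Fin N => c)).comp isometry_subtype_coe

theorem continuous_shift (N : ℕ) (c : ℝ) : Continuous (shift N c) :=
  (isometry_shift N c).continuous

theorem sum_shift {N : ℕ} (c : ℝ) (v : zeroSum N) : ∑ j, shift N c v j = N * c := by
  simp [shift, Finset.sum_add_distrib, mem_zeroSum.1 v.2]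

theorem exists_shift_eq {N : ℕ} {c : ℝ} {η : Fin N → ℝ} (h : ∑ j, η j = N * c) :
    ∃ v, shift N c v = η :=
  ⟨⟨fun j => η j - c, mem_zeroSum.2 (by simp [h])⟩, by ext j; simp [shift]⟩

/-- The uniform measure on the simplex `expSimplex N E`. -/
def simplexMeasure (N : ℕ) (E : ℝ) : Measure (Fin N → ℝ) :=
  (μH[(N : ℝ) - 1]).restrict (expSimplex N E)

/-- The Hausdorff measure of full dimension on the hyperplane `zeroSum N`. -/
def hyperplaneMeasure (N : ℕ) : Measure (zeroSum N) :=
  μH[(Module.finrank ℝ (zeroSum N) : ℝ)]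

instance (N : ℕ) : (hyperplaneMeasure N).IsAddHaarMeasure :=
  inferInstanceAs (μH[(Module.finrank ℝ (zeroSum N) : ℝ)]).IsAddHaarMeasure

theorem measurableSet_expSimplex (N : ℕ) (E : ℝ) : MeasurableSet (expSimplex N E) := by
  have h : expSimplex N E = Ici 0 ∩ {η | ∑ j, η j = N * E} := by
    ext η
    simp [expSimplex, Pi.le_def]
  rw [h]
  exact (isClosed_Ici.inter (isClosed_eq (by fun_prop) continuous_const)).measurableSet

theorem isOpen_posOrthant (N : ℕ) : IsOpen {η : Fin N → ℝ | ∀ j, 0 < η j} := by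
  simp only [Set.ofPred_forall]
  exact isOpen_iInter_of_finite fun j => isOpen_lt continuous_const (continuous_apply j)

theorem simplexMeasure_eq_map {N : ℕ} (hN : 2 ≤ N) (E : ℝ) :
    simplexMeasure N E =
      ((hyperplaneMeasure N).restrict (shift N E ⁻¹' expSimplex N E)).map (shift N E) := by
  rw [← Measure.restrict_map (continuous_shift N E).measurable (measurableSet_expSimplex N E),
    hyperplaneMeasure, (isometry_shift N E).map_hausdorffMeasure (Or.inl (Nat.cast_nonneg _)),
    Measure.restrict_restrict (measurableSet_expSimplex N E), finrank_zeroSum hN, simplexMeasure,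
    inter_eq_left.2]
  rintro η ⟨-, h⟩
  exact exists_shift_eq h

theorem hyperplaneMeasure_coord_eq {N : ℕ} (hN : 2 ≤ N) (c : ℝ) (j : Fin N) :
    hyperplaneMeasure N {v | shift N c v j = 0} = 0 := by
  let l : zeroSum N →ₗ[ℝ] ℝ := (LinearMap.proj j).comp (zeroSum N).subtype
  let s : AffineSubspace ℝ (zeroSum N) :=
    (AffineSubspace.mk' (-c) (⊥ : Submodule ℝ ℝ)).comap l.toAffineMap
  have hs : {v | shift N c v j = 0} = (s : Set (zeroSum N)) := by
    ext v
    simp [s, l, shift, AffineSubspace.mem_mk']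
  rw [hs]
  refine Measure.addHaar_affineSubspace _ _ fun htop => ?_
  have hall : ∀ v : zeroSum N, (v : Fin N → ℝ) j + c = 0 := fun v => by
    have : v ∈ {v | shift N c v j = 0} := by rw [hs, htop]; trivial
    exact this
  obtain ⟨i, hi⟩ : ∃ i : Fin N, i ≠ j :=
    haveI : Nontrivial (Fin N) := Fin.nontrivial_iff_two_le.2 hN
    exists_ne j
  have h0 := hall 0
  have h1 := hall ⟨Pi.single j 1 - Pi.single i 1, mem_zeroSum.2 (by simp)⟩
  simp [hi.symm] at h0 h1
  linarith

theorem ae_simplexMeasure_pos {N : ℕ} (hN : 2 ≤ N) (E : ℝ) :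
    ∀ᵐ η ∂simplexMeasure N E, ∀ j, 0 < η j := by
  rw [simplexMeasure_eq_map hN, ae_map_iff (continuous_shift N E).aemeasurable
    (isOpen_posOrthant N).measurableSet]
  have h1 : ∀ᵐ v ∂(hyperplaneMeasure N).restrict (shift N E ⁻¹' expSimplex N E),
      ∀ j, shift N E v j ≠ 0 :=
    ae_restrict_of_ae <| ae_all_iff.2 fun j => by
      simpa [ae_iff] using hyperplaneMeasure_coord_eq hN E j
  filter_upwards [h1, ae_restrict_mem
    ((continuous_shift N E).measurable (measurableSet_expSimplex N E))] with v hv hmem j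
  exact lt_of_le_of_ne (hmem.1 j) (hv j).symm

/-- Functions continuous on the open orthant that agree almost everywhere on the simplex agree
on its relative interior. -/
theorem eq_of_ae_simplexMeasure {N : ℕ} (hN : 2 ≤ N) {E : ℝ} {F G : (Fin N → ℝ) → ℝ}
    (hF : ContinuousOn F {η | ∀ j, 0 < η j}) (hG : ContinuousOn G {η | ∀ j, 0 < η j})
    (h : F =ᵐ[simplexMeasure N E] G) {η : Fin N → ℝ} (hη : ∀ j, 0 < η j)
    (hsum : ∑ j, η j = N * E) : F η = G η := by
  rw [simplexMeasure_eq_map hN] at h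
  have h' := ae_of_ae_map (continuous_shift N E).aemeasurable h
  have h'' := ae_restrict_of_ae_restrict_of_subset
    (s := shift N E ⁻¹' {η | ∀ j, 0 < η j})
    (fun v hv => (⟨fun j => (hv j).le, sum_shift E v⟩ : shift N E v ∈ expSimplex N E)) h'
  have hc := continuous_shift N E
  obtain ⟨v, rfl⟩ := exists_shift_eq hsum
  exact Measure.eqOn_open_of_ae_eq (f := F ∘ shift N E) (g := G ∘ shift N E) h''
    ((isOpen_posOrthant N).preimage hc) (hF.comp hc.continuousOn fun _ hv => hv)
    (hG.comp hc.continuousOn fun _ hv => hv) hη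

/-- The decomposition of a vector into its mean and its component in `zeroSum N`. -/
def meanEquiv {N : ℕ} (hN : 2 ≤ N) : (ℝ × zeroSum N) ≃ₗ[ℝ] (Fin N → ℝ) where
  toFun p := shift N p.1 p.2
  invFun η := ((∑ j, η j) / N, ⟨fun j => η j - (∑ j, η j) / N, mem_zeroSum.2 (by
    have : (N : ℝ) ≠ 0 := by positivity
    simp
    field_simp
    simp)⟩)
  map_add' p q := by
    ext j
    simp [shift]
    ring
  map_smul' r p := by
    ext j
    simp [shift]
    ring
  left_inv p := by
    have : (N : ℝ) ≠ 0 := by positivity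
    have h : (∑ j, shift N p.1 p.2 j) / N = p.1 := by
      rw [sum_shift, mul_div_cancel_left₀ _ this]
    refine Prod.ext h (Subtype.ext (funext fun j => ?_))
    change shift N p.1 p.2 j - (∑ j, shift N p.1 p.2 j) / N = _
    rw [h]
    simp [shift]
  right_inv η := by
    ext j
    simp [shift]

theorem ae_integrable_shift {N : ℕ} (hN : 2 ≤ N) {F : (Fin N → ℝ) → ℝ} (hF : Integrable F) :
    ∀ᵐ c : ℝ, Integrable (fun v => F (shift N c v)) (hyperplaneMeasure N) := by
  let L := (meanEquiv hN).toContinuousLinearEquiv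
  let μ : Measure (ℝ × zeroSum N) := (volume : Measure ℝ).prod (hyperplaneMeasure N)
  have h1 : Integrable F (μ.map L) := by
    rw [Measure.isAddLeftInvariant_eq_smul (μ.map L) volume]
    exact hF.smul_measure (by simp)
  have h2 : Integrable (F ∘ L) μ := h1.comp_measurable L.continuous.measurable
  exact h2.prod_right_ae

/-- The measure `μ` divided by its total mass. -/
def normalized {α : Type*} [MeasurableSpace α] (μ : Measure α) : Measure α :=
  (μ univ)⁻¹ • μ

theorem normalized_smul {α : Type*} [MeasurableSpace α] (μ : Measure α) {c : ENNReal}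
    (h0 : c ≠ 0) (htop : c ≠ ⊤) : normalized (c • μ) = normalized μ := by
  simp only [normalized, Measure.smul_apply, smul_eq_mul, smul_smul]
  rw [ENNReal.mul_inv (Or.inl h0) (Or.inl htop), mul_right_comm, ENNReal.inv_mul_cancel h0 htop,
    one_mul]

theorem map_normalized {α β : Type*} [MeasurableSpace α] [MeasurableSpace β] (μ : Measure α)
    {T : α → β} (hT : Measurable T) : (normalized μ).map T = normalized (μ.map T) := by
  simp [normalized, Measure.map_smul, Measure.map_apply hT MeasurableSet.univ]

theorem normalized_univ_ne_zero_iff {α : Type*} [MeasurableSpace α] {μ : Measure α}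
    (h0 : μ univ ≠ 0) : normalized μ univ ≠ 0 ↔ μ univ ≠ ⊤ := by
  simp [normalized, h0]

theorem smul_normalized {α : Type*} [MeasurableSpace α] {μ : Measure α}
    (h0 : μ univ ≠ 0) (htop : μ univ ≠ ⊤) : μ univ • normalized μ = μ := by
  rw [normalized, smul_smul, ENNReal.mul_inv_cancel h0 htop, one_smul]

theorem map_withDensity_comp {α β : Type*} [MeasurableSpace α] [MeasurableSpace β]
    (μ : Measure α) {T : α → β} (hT : Measurable T) {H : β → ENNReal} (hH : Measurable H) :
    (μ.withDensity (H ∘ T)).map T = (μ.map T).withDensity H := by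
  ext A hA
  rw [Measure.map_apply hT hA, withDensity_apply _ (hT hA), withDensity_apply _ hA,
    setLIntegral_map hA hH hT]
  rfl

open scoped Pointwise in
theorem map_simplexMeasure {N : ℕ} (hN : 2 ≤ N) (E : ℝ) {t : ℝ} (ht : 0 < t) :
    (simplexMeasure N E).map (fun η : Fin N → ℝ => t⁻¹ • η) =
      ((‖t‖₊ ^ ((N : ℝ) - 1) : NNReal) : ENNReal) • simplexMeasure N (E / t) := by
  have hd : (0 : ℝ) ≤ (N : ℝ) - 1 := by
    have : (2 : ℝ) ≤ N := by exact_mod_cast hN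
    linarith
  have hT : Measurable (fun η : Fin N → ℝ => t⁻¹ • η) := measurable_const_smul _
  ext A hA
  have hset : (fun η : Fin N → ℝ => t⁻¹ • η) ⁻¹' A ∩ expSimplex N E =
      t • (A ∩ expSimplex N (E / t)) := by
    ext η
    rw [Set.mem_smul_set_iff_inv_smul_mem₀ ht.ne']
    simp only [mem_inter_iff, mem_preimage, expSimplex, Set.mem_ofPred_eq, Pi.smul_apply,
      smul_eq_mul, ← Finset.mul_sum]
    refine and_congr_right fun _ => and_congr (forall_congr' fun j => ?_) ?_
    · rw [mul_nonneg_iff_of_pos_left (inv_pos.2 ht)]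
    · rw [inv_mul_eq_iff_eq_mul₀ ht.ne', mul_left_comm, mul_div_cancel₀ _ ht.ne']
  rw [Measure.map_apply hT hA, simplexMeasure, Measure.restrict_apply (hT hA), hset,
    Measure.hausdorffMeasure_smul₀ hd ht.ne', Measure.smul_apply, simplexMeasure,
    Measure.restrict_apply hA]
  rfl

/-- The product density `∏ j, f (η j)`, with `f` replaced by zero off `(0, ∞)`. -/
def prodDensity (f : ℝ → ℝ) (N : ℕ) (η : Fin N → ℝ) : ℝ :=
  ∏ j, (Ioi (0 : ℝ)).indicator f (η j)

theorem prodDensity_of_pos (f : ℝ → ℝ) {N : ℕ} {η : Fin N → ℝ} (hη : ∀ j, 0 < η j) :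
    prodDensity f N η = ∏ j, f (η j) :=
  Finset.prod_congr rfl fun j _ => indicator_of_mem (hη j) f

theorem prodDensity_smul_of_pos (f : ℝ → ℝ) {N : ℕ} {t : ℝ} (ht : 0 < t) {η : Fin N → ℝ}
    (hη : ∀ j, 0 < η j) : prodDensity f N (t • η) = ∏ j, f (t * η j) :=
  prodDensity_of_pos f fun j => mul_pos ht (hη j)

theorem prodDensity_nonneg {f : ℝ → ℝ} (hpos : ∀ x ∈ Ioi (0 : ℝ), 0 < f x) {N : ℕ}
    (η : Fin N → ℝ) : 0 ≤ prodDensity f N η :=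
  Finset.prod_nonneg fun _ _ => indicator_nonneg (fun x hx => (hpos x hx).le) _

theorem measurable_prodDensity {f : ℝ → ℝ} (hf : ContinuousOn f (Ioi 0)) (N : ℕ) :
    Measurable (prodDensity f N) := by
  have h : Measurable ((Ioi (0 : ℝ)).indicator f) := by
    rw [← piecewise_eq_indicator]
    exact hf.measurable_piecewise continuousOn_const measurableSet_Ioi
  exact Finset.measurable_prod _ fun j _ => h.comp (measurable_pi_apply j)

theorem measurable_ofReal_prodDensity_smul {f : ℝ → ℝ} (hf : ContinuousOn f (Ioi 0)) (N : ℕ)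
    (t : ℝ) : Measurable fun η : Fin N → ℝ => ENNReal.ofReal (prodDensity f N (t • η)) :=
  ((measurable_prodDensity hf N).comp (measurable_const_smul t)).ennreal_ofReal

theorem continuousOn_prodDensity_smul {f : ℝ → ℝ} (hf : ContinuousOn f (Ioi 0)) (N : ℕ) {t : ℝ}
    (ht : 0 < t) :
    ContinuousOn (fun η => prodDensity f N (t • η)) {η | ∀ j, 0 < η j} := by
  have h : ContinuousOn (fun η : Fin N → ℝ => ∏ j, f (t * η j)) {η | ∀ j, 0 < η j} :=
    continuousOn_finsetProd _ fun j _ =>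
      hf.comp (by fun_prop) fun η hη => mul_pos ht (hη j)
  exact h.congr fun η hη => prodDensity_smul_of_pos f ht hη

/-- The unnormalized measure on the simplex whose density at `η` is `∏ j, f (t * η j)`. -/
def scaledMeasure (f : ℝ → ℝ) (N : ℕ) (E t : ℝ) : Measure (Fin N → ℝ) :=
  (simplexMeasure N E).withDensity fun η => ENNReal.ofReal (prodDensity f N (t • η))

theorem condProduct_eq_normalized (f : ℝ → ℝ) {N : ℕ} (hN : 2 ≤ N) (E : ℝ) :
    condProduct f N E = normalized (scaledMeasure f N E 1) := by
  have h : scaledMeasure f N E 1 =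
      (simplexMeasure N E).withDensity fun η => ENNReal.ofReal (∏ j, f (η j)) := by
    refine withDensity_congr_ae ?_
    filter_upwards [ae_simplexMeasure_pos hN E] with η hη
    rw [one_smul, prodDensity_of_pos f hη]
  rw [h]
  rfl

theorem map_condProduct {f : ℝ → ℝ} (hf : ContinuousOn f (Ioi 0)) {N : ℕ} (hN : 2 ≤ N) (E : ℝ)
    {t : ℝ} (ht : 0 < t) :
    (condProduct f N E).map (fun η : Fin N → ℝ => t⁻¹ • η) =
      normalized (scaledMeasure f N (E / t) t) := by
  have hT : Measurable (fun η : Fin N → ℝ => t⁻¹ • η) := measurable_const_smul _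
  have hH := measurable_ofReal_prodDensity_smul hf N t
  have hc : (fun η : Fin N → ℝ => ENNReal.ofReal (prodDensity f N ((1 : ℝ) • η))) =
      (fun η : Fin N → ℝ => ENNReal.ofReal (prodDensity f N (t • η))) ∘
        fun η : Fin N → ℝ => t⁻¹ • η := by
    ext η
    simp [smul_smul, ht.ne']
  rw [condProduct_eq_normalized f hN, map_normalized _ hT, scaledMeasure, hc,
    map_withDensity_comp _ hT hH, map_simplexMeasure hN E ht, withDensity_smul_measure,
    normalized_smul _ _ ENNReal.coe_ne_top]
  · rfl
  · exact ENNReal.coe_ne_zero.2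
      (NNReal.rpow_pos (nnnorm_pos.2 ht.ne')).ne'

theorem normalized_scaledMeasure_eq {f : ℝ → ℝ} {N : ℕ} (hN : 2 ≤ N) {E t K : ℝ} (ht : 0 < t)
    (hK : 0 < K) (h : ∀ η : Fin N → ℝ, (∀ j, 0 < η j) → ∑ j, η j = N * E →
      ∏ j, f (t * η j) = K * ∏ j, f (η j)) :
    normalized (scaledMeasure f N E t) = normalized (scaledMeasure f N E 1) := by
  have : scaledMeasure f N E t = ENNReal.ofReal K • scaledMeasure f N E 1 := by
    rw [scaledMeasure, scaledMeasure, ← withDensity_smul' _ _ ENNReal.ofReal_ne_top]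
    refine withDensity_congr_ae ?_
    filter_upwards [ae_simplexMeasure_pos hN E,
      ae_restrict_mem (measurableSet_expSimplex N E)] with η hη hmem
    rw [Pi.smul_apply, smul_eq_mul, ← ENNReal.ofReal_mul hK.le, one_smul,
      prodDensity_of_pos f hη, ← h η hη hmem.2, prodDensity_smul_of_pos f ht hη]
  rw [this, normalized_smul _ (by simpa using hK) ENNReal.ofReal_ne_top]

theorem scaledMeasure_univ_ne_zero {f : ℝ → ℝ} (hf : ContinuousOn f (Ioi 0))
    (hpos : ∀ x ∈ Ioi (0 : ℝ), 0 < f x) {N : ℕ} (hN : 2 ≤ N) {E t : ℝ} (hE : 0 < E)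
    (ht : 0 < t) : scaledMeasure f N E t univ ≠ 0 := by
  intro h
  rw [scaledMeasure, withDensity_apply _ MeasurableSet.univ, Measure.restrict_univ,
    lintegral_eq_zero_iff (measurable_ofReal_prodDensity_smul hf N t)] at h
  have hae : (fun η => prodDensity f N (t • η)) =ᵐ[simplexMeasure N E] fun _ => 0 := by
    filter_upwards [h, ae_simplexMeasure_pos hN E] with η h0 hη
    exact le_antisymm (ENNReal.ofReal_eq_zero.1 h0) (prodDensity_nonneg hpos _)
  have h1 := eq_of_ae_simplexMeasure hN (continuousOn_prodDensity_smul hf N ht)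
    continuousOn_const hae (η := fun _ => E) (fun _ => hE) (by simp)
  have h2 : ∀ j : Fin N, 0 < (t • fun _ : Fin N => E) j := fun j => mul_pos ht hE
  rw [prodDensity_of_pos f h2] at h1
  exact (Finset.prod_pos fun j _ => hpos _ (h2 j)).ne' h1

theorem exists_scaledMeasure_univ_ne_top {f : ℝ → ℝ} (hint : IntegrableOn f (Ioi 0)) {N : ℕ}
    (hN : 2 ≤ N) : ∃ E, 0 < E ∧ scaledMeasure f N E 1 univ ≠ ⊤ := by
  have hF : Integrable (prodDensity f N) :=
    Integrable.fintype_prod (f := fun _ : Fin N => (Ioi (0 : ℝ)).indicator f)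
      fun _ => hint.integrable_indicator measurableSet_Ioi
  have hae := ae_restrict_of_ae (s := Ioi (0 : ℝ)) (ae_integrable_shift hN hF)
  have : NeZero ((volume : Measure ℝ).restrict (Ioi 0)) := ⟨by simp⟩
  obtain ⟨E, hE, hpos⟩ := (hae.and (ae_restrict_mem measurableSet_Ioi)).exists
  refine ⟨E, hpos, ne_of_lt ?_⟩
  rw [scaledMeasure, withDensity_apply _ MeasurableSet.univ, Measure.restrict_univ,
    simplexMeasure_eq_map hN,
    ((isometry_shift N E).isClosedEmbedding.measurableEmbedding).lintegral_map]
  simp only [one_smul]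
  exact (setLIntegral_le_lintegral _ _).trans_lt hE.lintegral_lt_top

theorem prod_eq_of_scaling {f : ℝ → ℝ} (hf : ContinuousOn f (Ioi 0))
    (hpos : ∀ x ∈ Ioi (0 : ℝ), 0 < f x) (hint : IntegrableOn f (Ioi 0)) {N : ℕ} (hN : 2 ≤ N)
    {E : ℝ} (hE : 0 < E)
    (h : ∀ t : ℝ, 0 < t → (condProduct f N E).map (fun η : Fin N → ℝ => t⁻¹ • η) =
      condProduct f N (E / t)) {t : ℝ} (ht : 0 < t) :
    ∃ K : ℝ, ∀ η : Fin N → ℝ, (∀ j, 0 < η j) → ∑ j, η j = N * (E / t) →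
      ∏ j, f (t * η j) = K * ∏ j, f (η j) := by
  have hnorm : ∀ s : ℝ, 0 < s →
      normalized (scaledMeasure f N (E / s) s) = normalized (scaledMeasure f N (E / s) 1) :=
    fun s hs => by rw [← map_condProduct hf hN E hs, h s hs, condProduct_eq_normalized f hN]
  have hT : ∀ s : ℝ, Measurable fun η : Fin N → ℝ => s⁻¹ • η :=
    fun s => measurable_const_smul _
  have hmass : ∀ s : ℝ, 0 < s →
      normalized (scaledMeasure f N (E / s) s) univ = condProduct f N E univ := fun s hs => by
    rw [← map_condProduct hf hN E hs, Measure.map_apply (hT s) MeasurableSet.univ, preimage_univ]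
  have hE0 : condProduct f N E univ ≠ 0 := by
    obtain ⟨c, hc, hfin⟩ := exists_scaledMeasure_univ_ne_top hint hN
    have hs : 0 < E / c := div_pos hE hc
    have h1 := scaledMeasure_univ_ne_zero hf hpos hN hc one_pos
    rw [← hmass _ hs, hnorm _ hs, div_div_cancel₀ hE.ne']
    exact (normalized_univ_ne_zero_iff h1).2 hfin
  have hEt : 0 < E / t := div_pos hE ht
  have hA0 := scaledMeasure_univ_ne_zero hf hpos hN hEt ht
  have hA : scaledMeasure f N (E / t) t univ ≠ ⊤ :=
    (normalized_univ_ne_zero_iff hA0).1 (by rwa [hmass t ht])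
  have heq : scaledMeasure f N (E / t) t =
      (scaledMeasure f N (E / t) t univ / scaledMeasure f N (E / t) 1 univ) •
        scaledMeasure f N (E / t) 1 := by
    conv_lhs => rw [← smul_normalized hA0 hA, hnorm t ht, normalized, smul_smul, ← div_eq_mul_inv]
  generalize scaledMeasure f N (E / t) t univ / scaledMeasure f N (E / t) 1 univ = K at heq
  have hm := measurable_ofReal_prodDensity_smul hf N
  rw [scaledMeasure, scaledMeasure, ← withDensity_smul _ (hm 1), withDensity_eq_iff
    (hm t).aemeasurable ((hm 1).const_smul K).aemeasurable] at heq
  · have hae : (fun η => prodDensity f N (t • η)) =ᵐ[simplexMeasure N (E / t)]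
        fun η => K.toReal * prodDensity f N ((1 : ℝ) • η) := by
      filter_upwards [heq] with η hη
      simpa [ENNReal.toReal_mul, ENNReal.toReal_ofReal (prodDensity_nonneg hpos _)]
        using congrArg ENNReal.toReal hη
    refine ⟨K.toReal, fun η hη hsum => ?_⟩
    have := eq_of_ae_simplexMeasure hN (continuousOn_prodDensity_smul hf N ht)
      (continuousOn_const.mul (continuousOn_prodDensity_smul hf N one_pos)) hae hη hsum
    rwa [Pi.mul_apply, one_smul, prodDensity_of_pos f hη, prodDensity_smul_of_pos f ht hη] at this
  · rwa [scaledMeasure, withDensity_apply _ MeasurableSet.univ, Measure.restrict_univ] at hA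

/-- A continuous function on `(0, ∞)` that takes the mean of its values at two points at their
midpoint is affine. -/
theorem exists_affine_of_midpoint {k : ℝ → ℝ} (hk : ContinuousOn k (Ioi 0))
    (h : ∀ x y, 0 < x → 0 < y → k x + k y = 2 * k ((x + y) / 2)) :
    ∃ m c : ℝ, ∀ x ∈ Ioi (0 : ℝ), k x = m * x + c := by
  let φ : ℝ → ℝ := fun u => 2 * k (max u 1 / 2)
  have hφ : Continuous φ :=
    continuous_const.mul (hk.comp_continuous (by fun_prop) fun u => by
      have : (0 : ℝ) < max u 1 := lt_max_of_lt_right one_pos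
      exact half_pos this)
  have hadd : ∀ x y, 0 < x → 1 ≤ y → k x + k y = φ (x + y) := fun x y hx hy => by
    rw [h x y hx (by linarith)]
    simp only [φ]
    rw [max_eq_left (by linarith)]
  have hint : ∀ x ∈ Ioi (0 : ℝ),
      k x = (∫ u in (0 : ℝ)..(x + 2), φ u) - (∫ u in (0 : ℝ)..(x + 1), φ u)
        - ∫ y in (1 : ℝ)..2, k y := fun x hx => by
    have hki : IntervalIntegrable k volume 1 2 :=
      (hk.mono fun y hy => by
        rw [uIcc_of_le one_le_two] at hy
        exact lt_of_lt_of_le one_pos hy.1).intervalIntegrable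
    rw [intervalIntegral.integral_interval_sub_left (hφ.intervalIntegrable _ _)
      (hφ.intervalIntegrable _ _), ← intervalIntegral.integral_comp_add_left,
      ← intervalIntegral.integral_sub
        (Continuous.intervalIntegrable (by fun_prop) _ _) hki,
      intervalIntegral.integral_congr (g := fun _ => k x)]
    · rw [intervalIntegral.integral_const]
      norm_num
    · intro y hy
      rw [uIcc_of_le one_le_two] at hy
      simp only
      linarith [hadd x y hx hy.1]
  have hderiv : ∀ x ∈ Ioi (0 : ℝ), HasDerivAt (fun x => k x - (k 2 - k 1) * x) 0 x := by
    intro x hx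
    have hd : ∀ a u, HasDerivAt (fun x => ∫ u in (0 : ℝ)..(x + a), φ u) (φ (u + a)) u :=
      fun a u => HasDerivAt.comp_add_const u a
        (hφ.integral_hasStrictDerivAt 0 (u + a)).hasDerivAt
    have hk' : HasDerivAt k (φ (x + 2) - φ (x + 1)) x :=
      (((hd 2 x).sub (hd 1 x)).sub_const _).congr_of_eventuallyEq
        (Filter.eventually_of_mem (Ioi_mem_nhds hx) hint)
    refine (hk'.sub ((hasDerivAt_id x).const_mul (k 2 - k 1))).congr_deriv ?_
    rw [← hadd x 2 hx one_le_two, ← hadd x 1 hx le_rfl]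
    ring
  obtain ⟨c, hc⟩ := isOpen_Ioi.exists_is_const_of_deriv_eq_zero isPreconnected_Ioi
    (fun x hx => (hderiv x hx).differentiableAt.differentiableWithinAt)
    fun x hx => (hderiv x hx).deriv
  exact ⟨k 2 - k 1, c, fun x hx => by linarith [hc x hx]⟩

/-- If the products `∏ j, f (η j)` on the open simplices of a fixed dimension are scale invariant
up to constants, then the sums of `x ↦ x * f' x / f x` depend only on the sum of the points. -/
theorem sum_mul_logDeriv_eq {f : ℝ → ℝ} (hf : ContDiffOn ℝ 1 f (Ioi 0))
    (hpos : ∀ x ∈ Ioi (0 : ℝ), 0 < f x) {N : ℕ} (hN : 2 ≤ N) {E : ℝ} (hE : 0 < E)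
    (h : ∀ t : ℝ, 0 < t → ∃ K : ℝ, ∀ η : Fin N → ℝ, (∀ j, 0 < η j) → ∑ j, η j = N * (E / t) →
      ∏ j, f (t * η j) = K * ∏ j, f (η j))
    {ζ ξ : Fin N → ℝ} (hζ : ∀ j, 0 < ζ j) (hξ : ∀ j, 0 < ξ j) (hsum : ∑ j, ζ j = ∑ j, ξ j) :
    ∑ j, ζ j * (deriv f (ζ j) / f (ζ j)) = ∑ j, ξ j * (deriv f (ξ j) / f (ξ j)) := by
  have hN0 : (0 : ℝ) < N := by positivity
  have hne : (Finset.univ : Finset (Fin N)).Nonempty := ⟨⟨0, by omega⟩, Finset.mem_univ _⟩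
  have hS : 0 < ∑ j, ζ j := Finset.sum_pos (fun j _ => hζ j) hne
  set s : ℝ := (∑ j, ζ j) / (N * E) with hs
  have hspos : 0 < s := by positivity
  have hconst : ∀ r : ℝ, 0 < r →
      ∑ j, Real.log (f (r * ζ j)) - ∑ j, Real.log (f (r * ξ j)) =
        ∑ j, Real.log (f (s⁻¹ * ζ j)) - ∑ j, Real.log (f (s⁻¹ * ξ j)) := by
    intro r hr
    obtain ⟨K, hK⟩ := h (s⁻¹ * r⁻¹) (by positivity)
    have key : ∀ η : Fin N → ℝ, (∀ j, 0 < η j) → ∑ j, η j = N * E * s →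
        ∑ j, Real.log (f (s⁻¹ * η j)) =
          Real.log K + ∑ j, Real.log (f (r * η j)) := by
      intro η hη hsη
      have h1 := hK (fun j => r * η j) (fun j => mul_pos hr (hη j)) (by
        rw [← Finset.mul_sum, hsη]
        field_simp)
      have h2 : ∀ j, s⁻¹ * r⁻¹ * (r * η j) = s⁻¹ * η j := fun j => by field_simp
      simp only [h2] at h1
      have hp1 : ∀ j, 0 < f (s⁻¹ * η j) := fun j => hpos _ (mul_pos (inv_pos.2 hspos) (hη j))
      have hp2 : ∀ j, 0 < f (r * η j) := fun j => hpos _ (mul_pos hr (hη j))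
      have hP2 : 0 < ∏ j, f (r * η j) := Finset.prod_pos fun j _ => hp2 j
      have hKpos : 0 < K := by
        have : 0 < K * ∏ j, f (r * η j) := h1 ▸ Finset.prod_pos fun j _ => hp1 j
        exact pos_of_mul_pos_left this hP2.le
      rw [← Real.log_prod fun j _ => (hp1 j).ne', ← Real.log_prod fun j _ => (hp2 j).ne', h1,
        Real.log_mul hKpos.ne' hP2.ne']
    have hsζ : ∑ j, ζ j = N * E * s := by
      rw [hs]
      field_simp
    have k1 := key ζ hζ hsζ
    have k2 := key ξ hξ (hsum ▸ hsζ)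
    linarith
  have hdf : ∀ x, 0 < x → HasDerivAt f (deriv f x) x := fun x hx =>
    ((hf.differentiableOn one_ne_zero).differentiableAt (Ioi_mem_nhds hx)).hasDerivAt
  have hd : ∀ η : Fin N → ℝ, (∀ j, 0 < η j) →
      HasDerivAt (fun r : ℝ => ∑ j, Real.log (f (r * η j)))
        (∑ j, η j * (deriv f (η j) / f (η j))) 1 := by
    intro η hη
    refine HasDerivAt.fun_sum fun j _ => ?_
    have hj : HasDerivAt f (deriv f (η j)) (1 * η j) := by
      rw [one_mul]
      exact hdf _ (hη j)
    have h1 := (hj.comp 1 ((hasDerivAt_id (1 : ℝ)).mul_const (η j))).log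
      (by simpa using (hpos _ (hη j)).ne')
    refine h1.congr_deriv ?_
    simp
    ring
  have h0 := (hasDerivAt_const (1 : ℝ)
    (∑ j, Real.log (f (s⁻¹ * ζ j)) - ∑ j, Real.log (f (s⁻¹ * ξ j)))).congr_of_eventuallyEq
      (Filter.eventually_of_mem (Ioi_mem_nhds one_pos) hconst)
  exact sub_eq_zero.1 (((hd ζ hζ).sub (hd ξ hξ)).unique h0)

theorem exists_rpow_mul_exp_of_prod_eq {f : ℝ → ℝ} (hf : ContDiffOn ℝ 1 f (Ioi 0))
    (hpos : ∀ x ∈ Ioi (0 : ℝ), 0 < f x) {N : ℕ} (hN : 2 ≤ N) {E : ℝ} (hE : 0 < E)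
    (h : ∀ t : ℝ, 0 < t → ∃ K : ℝ, ∀ η : Fin N → ℝ, (∀ j, 0 < η j) → ∑ j, η j = N * (E / t) →
      ∏ j, f (t * η j) = K * ∏ j, f (η j)) :
    ∃ C a l : ℝ, 0 < C ∧
      ∀ x ∈ Ioi (0 : ℝ), f x = C * (x ^ (a - 1) * Real.exp (-(l * x))) := by
  let k : ℝ → ℝ := fun x => x * (deriv f x / f x)
  have hk : ContinuousOn k (Ioi 0) :=
    continuousOn_id.mul ((hf.continuousOn_deriv_of_isOpen isOpen_Ioi le_rfl).div hf.continuousOn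
      fun x hx => (hpos x hx).ne')
  have hmid : ∀ x y, 0 < x → 0 < y → k x + k y = 2 * k ((x + y) / 2) := by
    intro x y hx hy
    obtain ⟨n, rfl⟩ := Nat.exists_eq_add_of_le' hN
    have hv : ∀ p q : ℝ, 0 < p → 0 < q →
        ∀ j : Fin (n + 2), 0 < (Fin.cons p (Fin.cons q fun _ => 1 : Fin (n + 1) → ℝ) :
          Fin (n + 2) → ℝ) j := fun p q hp hq j => by
      refine Fin.cases ?_ (fun i => Fin.cases ?_ (fun _ => ?_) i) j <;> simp [hp, hq]
    have hm : 0 < (x + y) / 2 := by positivity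
    have := sum_mul_logDeriv_eq hf hpos hN hE h (hv x y hx hy) (hv _ _ hm hm) (by
      simp [Fin.sum_univ_succ]
      ring)
    simp [Fin.sum_univ_succ] at this
    simp only [k]
    linarith
  obtain ⟨m, c, hmc⟩ := exists_affine_of_midpoint hk hmid
  have hderiv : ∀ x ∈ Ioi (0 : ℝ),
      HasDerivAt (fun x => Real.log (f x) - (m * x + c * Real.log x)) 0 x := by
    intro x hx
    have hx0 : x ≠ 0 := ne_of_gt hx
    have hfx := (hpos x hx).ne'
    have h1 := (((hf.differentiableOn one_ne_zero).differentiableAt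
      (Ioi_mem_nhds hx)).hasDerivAt).log hfx
    refine (h1.sub (((hasDerivAt_id x).const_mul m).add
      ((Real.hasDerivAt_log hx0).const_mul c))).congr_deriv ?_
    have h2 : x * (deriv f x / f x) = m * x + c := hmc x hx
    have h3 : deriv f x / f x = (m * x + c) / x := by
      rw [← h2]
      field_simp
    rw [h3]
    field_simp
    ring
  obtain ⟨b, hb⟩ := isOpen_Ioi.exists_is_const_of_deriv_eq_zero isPreconnected_Ioi
    (fun x hx => (hderiv x hx).differentiableAt.differentiableWithinAt)
    fun x hx => (hderiv x hx).deriv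
  refine ⟨Real.exp b, c + 1, -m, Real.exp_pos b, fun x hx => ?_⟩
  have h1 : Real.log (f x) = b + (Real.log x * c + m * x) := by linarith [hb x hx]
  rw [← Real.exp_log (hpos x hx), h1, Real.exp_add, Real.exp_add, add_sub_cancel_right,
    Real.rpow_def_of_pos hx, neg_mul, neg_neg]

theorem pos_of_integrableOn_rpow_mul_exp {a l : ℝ}
    (h : IntegrableOn (fun x : ℝ => x ^ (a - 1) * Real.exp (-(l * x))) (Ioi 0)) :
    0 < a ∧ 0 < l := by
  have ha : 0 < a := by
    have h1 : IntegrableOn (fun x : ℝ => x ^ (a - 1)) (Ioo 0 1) := by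
      refine Integrable.mono' ((h.mono_set Ioo_subset_Ioi_self).const_mul (Real.exp |l|))
        (by fun_prop) ?_
      filter_upwards [ae_restrict_mem measurableSet_Ioo] with x hx
      have hx0 : 0 ≤ x ^ (a - 1) := Real.rpow_nonneg hx.1.le _
      have he : 1 ≤ Real.exp |l| * Real.exp (-(l * x)) := by
        rw [← Real.exp_add, Real.one_le_exp_iff]
        nlinarith [hx.1, hx.2, le_abs_self l, abs_nonneg l]
      rw [Real.norm_of_nonneg hx0]
      nlinarith
    have := (intervalIntegral.integrableOn_Ioo_rpow_iff one_pos).1 h1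
    linarith
  refine ⟨ha, ?_⟩
  by_contra! hl
  have h1 : IntegrableOn (fun x : ℝ => x ^ (a - 1)) (Ioi 1) := by
    refine Integrable.mono' (h.mono_set (Ioi_subset_Ioi zero_le_one)) (by fun_prop) ?_
    filter_upwards [ae_restrict_mem measurableSet_Ioi] with x hx
    have hx1 : (0 : ℝ) < x := lt_trans one_pos hx
    have hx0 : 0 ≤ x ^ (a - 1) := Real.rpow_nonneg hx1.le _
    have he : 1 ≤ Real.exp (-(l * x)) := by
      rw [Real.one_le_exp_iff]
      nlinarith
    rw [Real.norm_of_nonneg hx0]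
    nlinarith
  have := (integrableOn_Ioi_rpow_iff one_pos).1 h1
  linarith

theorem prod_gamma_smul {f : ℝ → ℝ} {C a l : ℝ}
    (h : ∀ x ∈ Ioi (0 : ℝ), f x = C * x ^ (a - 1) * Real.exp (-(l * x))) {N : ℕ} {t : ℝ}
    (ht : 0 < t) {η : Fin N → ℝ} (hη : ∀ j, 0 < η j) :
    ∏ j, f (t * η j) =
      (t ^ (a - 1)) ^ N * Real.exp (l * (1 - t) * ∑ j, η j) * ∏ j, f (η j) := by
  have hj : ∀ j, f (t * η j) = t ^ (a - 1) * Real.exp (l * (1 - t) * η j) * f (η j) := by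
    intro j
    rw [h _ (mul_pos ht (hη j)), h _ (hη j), Real.mul_rpow ht.le (hη j).le]
    have : Real.exp (-(l * (t * η j))) =
        Real.exp (l * (1 - t) * η j) * Real.exp (-(l * η j)) := by
      rw [← Real.exp_add]
      ring_nf
    rw [this]
    ring
  simp only [hj, Finset.prod_mul_distrib, Finset.prod_const, Finset.card_univ, Fintype.card_fin,
    ← Real.exp_sum, ← Finset.mul_sum]

/-- Let `f` be a continuously differentiable, strictly positive
probability density on `(0,∞)`. For fixed `N ≥ 2` and `E > 0`, the push-forward identity
`S_t # σ_{f,N,E} = σ_{f,N,E/t}` (where `S_t(η) = t⁻¹·η` maps `S_{N,E}` onto `S_{N,E/t}`)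
holds for all `t > 0` if and only if `f` is a Gamma density, i.e.
`f(x) = (λ^α/Γ(α))·x^{α−1}·e^{−λx}` on `(0,∞)` for some `α, λ > 0`. -/
theorem scaling_invariance_iff_gamma_density (N : ℕ) (hN : 2 ≤ N) (E : ℝ) (hE : 0 < E)
    (f : ℝ → ℝ) (hf : ContDiffOn ℝ 1 f (Set.Ioi 0))
    (hpos : ∀ x ∈ Set.Ioi (0:ℝ), 0 < f x)
    (hprob : (∫ x in Set.Ioi (0:ℝ), f x) = 1) :
    (∀ t : ℝ, 0 < t →
        Measure.map (fun η : Fin N → ℝ => t⁻¹ • η) (condProduct f N E) =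
          condProduct f N (E / t)) ↔
    (∃ a l : ℝ, 0 < a ∧ 0 < l ∧ ∀ x ∈ Set.Ioi (0:ℝ),
        f x = l ^ a / Real.Gamma a * x ^ (a - 1) * Real.exp (-(l * x))) := by
  have hint : IntegrableOn f (Ioi 0) := by
    by_contra hni
    rw [integral_undef hni] at hprob
    exact zero_ne_one hprob
  constructor
  · intro h
    obtain ⟨C, a, l, hC, hform⟩ := exists_rpow_mul_exp_of_prod_eq hf hpos hN hE
      fun t ht => prod_eq_of_scaling hf.continuousOn hpos hint hN hE h ht
    have hint' : IntegrableOn (fun x : ℝ => x ^ (a - 1) * Real.exp (-(l * x))) (Ioi 0) := by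
      have h1 : IntegrableOn (fun x : ℝ => C * (x ^ (a - 1) * Real.exp (-(l * x)))) (Ioi 0) :=
        hint.congr_fun hform measurableSet_Ioi
      simpa [IntegrableOn, ← mul_assoc, hC.ne'] using h1.const_mul C⁻¹
    obtain ⟨ha, hl⟩ := pos_of_integrableOn_rpow_mul_exp hint'
    refine ⟨a, l, ha, hl, fun x hx => ?_⟩
    rw [setIntegral_congr_fun measurableSet_Ioi hform, integral_const_mul,
      Real.integral_rpow_mul_exp_neg_mul_Ioi ha hl, Real.div_rpow zero_le_one hl.le,
      Real.one_rpow] at hprob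
    have hG := Real.Gamma_pos_of_pos ha
    have hla : 0 < l ^ a := Real.rpow_pos_of_pos hl a
    have hCeq : C = l ^ a / Real.Gamma a := by
      field_simp at hprob ⊢
      exact hprob
    rw [hform x hx, hCeq, mul_assoc]
  · rintro ⟨a, l, -, -, hform⟩ t ht
    rw [map_condProduct hf.continuousOn hN E ht, condProduct_eq_normalized f hN]
    refine normalized_scaledMeasure_eq hN ht
      (K := (t ^ (a - 1)) ^ N * Real.exp (l * (1 - t) * (N * (E / t)))) (by positivity) ?_
    intro η hη hsum
    rw [prod_gamma_smul hform ht hη, hsum]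

end
end
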